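/- Let k ≥ 3 be an integer, α, β ∈ ℝ∖ℤ, and x ∈ ℂ with Re(x) > 0. Define F_k(x, α, β) := −x · ∫₀^∞ Li_{k−2}(e^{−xt} e^{2πiα}) · Li₁(e^{−t} e^{2πiβ}) dt. Then F_k(x, α, β) = Log(1 − e^{2πiβ}) · Li_{k−1}(e^{2πiα}) + 𝓕_k(x; α, β) − (1/x) · Li_k(e^{2πiα}). -/

import Mathlib

open Complex MeasureTheory Filter Topology Set Asymptotics

noncomputable section

/-- `e2pi θ = e^{2πiθ}`. -/
def e2pi (θ : ℝ) : ℂ := Complex.exp (2 * Real.pi * Complex.I * θ)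

/-- Polylogarithm of integer order: `Li 0 z = z/(1-z)`, `Li 1 z = -Log(1-z)`,
`Li m z = ∑_{n≥1} z^n/n^m` for `m ≥ 2`. -/
def Li : ℕ → ℂ → ℂ
  | 0, z => z / (1 - z)
  | 1, z => -Complex.log (1 - z)
  | (m+2), z => ∑' n : ℕ, z ^ (n+1) / ((n+1 : ℕ) : ℂ) ^ (m+2)

/-- The higher Herglotz–Zagier–Novikov function
`𝓕_k(x; α, β) = ∫₀^∞ Li_{k-1}(e^{-xt} e^{2πiα}) / (1 - e^{-t} e^{2πiβ}) dt`. -/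
def HHZN (k : ℕ) (x : ℂ) (α β : ℝ) : ℂ :=
  ∫ t in Set.Ioi (0:ℝ),
    Li (k-1) (Complex.exp (-x * t) * e2pi α) / (1 - Complex.exp (-(t:ℂ)) * e2pi β)

lemma Li_zero (m : ℕ) : Li (m+1) 0 = 0 := by
  cases m <;> simp [Li]

lemma Li_eq_tsum (m : ℕ) {z : ℂ} (hz : ‖z‖ < 1) :
    Li (m+1) z = ∑' n : ℕ, z ^ (n+1) / ((n+1 : ℕ) : ℂ) ^ (m+1) := by
  cases m with
  | zero =>
    have := (Complex.hasSum_taylorSeries_neg_log' hz).tsum_eq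
    simp only [Li]
    rw [← this]
    simp
  | succ m => rfl

lemma Li_hasDerivAt (m : ℕ) {z : ℂ} (hz : ‖z‖ < 1) :
    HasDerivAt (Li (m+2)) (∑' n : ℕ, z ^ n / ((n+1 : ℕ) : ℂ) ^ (m+1)) z := by
  obtain ⟨r, hr1, hr2⟩ := exists_between hz
  have hr0 : 0 ≤ r := (norm_nonneg z).trans hr1.le
  have h := hasDerivAt_tsum_of_isPreconnected (𝕜 := ℂ) (F := ℂ)
    (g := fun (n : ℕ) (z : ℂ) => z ^ (n+1) / ((n+1 : ℕ) : ℂ) ^ (m+2))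
    (g' := fun (n : ℕ) (z : ℂ) => z ^ n / ((n+1 : ℕ) : ℂ) ^ (m+1))
    (u := fun n => r ^ n) (t := Metric.ball 0 r) (y₀ := 0) (y := z)
    (summable_geometric_of_lt_one hr0 hr2) Metric.isOpen_ball
    (convex_ball _ _).isPreconnected ?_ ?_ ?_ ?_ ?_
  · exact h
  · intro n y _
    have := (hasDerivAt_pow (n+1) y).div_const (((n+1 : ℕ) : ℂ) ^ (m+2))
    convert! this using 1
    have h0 : ((n+1 : ℕ) : ℂ) ≠ 0 := Nat.cast_ne_zero.mpr (by omega)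
    simp only [Nat.add_sub_cancel]
    field_simp
    ring
  · intro n y hy
    have hy' : ‖y‖ < r := by simpa using hy
    rw [norm_div, norm_pow, norm_pow, Complex.norm_natCast]
    have h1 : (1:ℝ) ≤ ((n+1 : ℕ) : ℝ) ^ (m+1) := one_le_pow₀ (by push_cast; linarith [n.cast_nonneg (α := ℝ)])
    calc ‖y‖ ^ n / ((n+1 : ℕ) : ℝ) ^ (m+1) ≤ ‖y‖ ^ n := div_le_self (by positivity) h1
      _ ≤ r ^ n := by gcongr
  · simpa using (norm_nonneg z).trans_lt hr1
  · simp
  · simpa using hr1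

lemma mul_deriv_Li (m : ℕ) {z : ℂ} (hz : ‖z‖ < 1) :
    z * (∑' n : ℕ, z ^ n / ((n+1 : ℕ) : ℂ) ^ (m+1)) = Li (m+1) z := by
  rw [Li_eq_tsum m hz, ← tsum_mul_left]
  congr 1; ext n; ring

lemma Li_one_hasDerivAt {z : ℂ} (hz : ‖z‖ < 1) :
    HasDerivAt (Li 1) (1 / (1 - z)) z := by
  have hm : 1 - z ∈ slitPlane := by
    left
    have := (Complex.re_le_norm z)
    simp; linarith
  have h := (((hasDerivAt_id z).const_sub 1).clog hm).neg
  convert! h using 1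
  simp [neg_div]

lemma Li_isBigO (m : ℕ) : Li (m+1) =O[𝓝 0] (fun z => z) := by
  have : DifferentiableAt ℂ (Li (m+1)) 0 := by
    cases m with
    | zero => exact (Li_one_hasDerivAt (by simp)).differentiableAt
    | succ m => exact (Li_hasDerivAt m (by simp)).differentiableAt
  simpa [Li_zero] using this.isBigO_sub

lemma Li_continuousOn (m : ℕ) :
    ContinuousOn (Li (m+1)) {z | ‖z‖ ≤ 1 ∧ z ≠ 1} := by
  cases m with
  | zero =>
    show ContinuousOn (fun z => -Complex.log (1 - z)) _
    refine (ContinuousOn.clog (by fun_prop) ?_).neg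
    rintro z ⟨hz, hz1⟩
    rw [Complex.mem_slitPlane_iff]
    by_contra! hcon
    obtain ⟨h1, h2⟩ := hcon
    simp at h1 h2
    have h3 := Complex.re_le_norm z
    apply hz1
    apply Complex.ext
    · simp; linarith
    · simpa using h2
  | succ m =>
    show ContinuousOn (fun z => ∑' n : ℕ, z ^ (n+1) / ((n+1 : ℕ) : ℂ) ^ (m+2)) _
    refine continuousOn_tsum (u := fun n : ℕ => 1 / ((n+1 : ℕ) : ℝ) ^ (m+2)) (fun n => by fun_prop) ?_ ?_
    · exact (summable_nat_add_iff 1).2 ((Real.summable_one_div_nat_pow (p := m+2)).2 (by omega))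
    · rintro n z ⟨hz, -⟩
      rw [norm_div, norm_pow, norm_pow, Complex.norm_natCast]
      gcongr
      exact pow_le_one₀ (norm_nonneg _) hz

lemma norm_e2pi (θ : ℝ) : ‖e2pi θ‖ = 1 := by
  have : (2 * Real.pi * Complex.I * θ : ℂ) = ((2 * Real.pi * θ : ℝ) : ℂ) * I := by
    push_cast; ring
  rw [e2pi, this, Complex.norm_exp_ofReal_mul_I]

lemma e2pi_ne_one {θ : ℝ} (h : ∀ n : ℤ, θ ≠ n) : e2pi θ ≠ 1 := by
  intro h1
  obtain ⟨n, hn⟩ := Complex.exp_eq_one_iff.1 h1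
  apply h n
  have h2 : (2 * Real.pi * I : ℂ) ≠ 0 := Complex.two_pi_I_ne_zero
  have h3 : (θ : ℂ) = n := mul_left_cancel₀ h2 (by rw [hn]; ring)
  exact_mod_cast h3

/-- the inner argument -/
def arg0 (x : ℂ) (θ : ℝ) (t : ℝ) : ℂ := Complex.exp (-x * t) * e2pi θ

lemma norm_arg0 (x : ℂ) (θ t : ℝ) : ‖arg0 x θ t‖ = Real.exp (-x.re * t) := by
  simp [arg0, norm_e2pi, Complex.norm_exp]

lemma arg0_lt {x : ℂ} (hx : 0 < x.re) (θ : ℝ) {t : ℝ} (ht : 0 < t) : ‖arg0 x θ t‖ < 1 := by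
  rw [norm_arg0, Real.exp_lt_one_iff]
  nlinarith

lemma arg0_mem {x : ℂ} (hx : 0 < x.re) {θ : ℝ} (h : ∀ n : ℤ, θ ≠ n) {t : ℝ} (ht : 0 ≤ t) :
    arg0 x θ t ∈ {z : ℂ | ‖z‖ ≤ 1 ∧ z ≠ 1} := by
  rcases ht.eq_or_lt with rfl | ht
  · simpa [arg0, norm_e2pi] using e2pi_ne_one h
  · have := arg0_lt hx θ ht
    exact ⟨this.le, fun h => by simp [h] at this⟩

lemma arg0_continuous (x : ℂ) (θ : ℝ) : Continuous (arg0 x θ) := by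
  unfold arg0; fun_prop

lemma arg0_hasDerivAt (x : ℂ) (θ t : ℝ) : HasDerivAt (arg0 x θ) (-x * arg0 x θ t) t := by
  have h1 : HasDerivAt (fun t : ℝ => -x * (t:ℂ)) (-x) t := by
    simpa using (Complex.ofRealCLM.hasDerivAt (x := t)).const_mul (-x)
  convert! h1.cexp.mul_const (e2pi θ) using 1
  simp only [arg0]; ring

lemma arg0_tendsto {x : ℂ} (hx : 0 < x.re) (θ : ℝ) : Tendsto (arg0 x θ) atTop (𝓝 0) := by
  rw [tendsto_zero_iff_norm_tendsto_zero]
  simp_rw [norm_arg0]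
  exact Real.tendsto_exp_atBot.comp (tendsto_id.const_mul_atTop_of_neg (by linarith))

lemma G_cont (m : ℕ) {x : ℂ} (hx : 0 < x.re) {θ : ℝ} (h : ∀ n : ℤ, θ ≠ n) :
    ContinuousOn (fun t => Li (m+1) (arg0 x θ t)) (Ici 0) :=
  (Li_continuousOn m).comp (arg0_continuous x θ).continuousOn (fun _ ht => arg0_mem hx h ht)

lemma G_bigO (m : ℕ) {x : ℂ} (hx : 0 < x.re) (θ : ℝ) :
    (fun t => Li (m+1) (arg0 x θ t)) =O[atTop] (fun t => Real.exp (-x.re * t)) := by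
  refine ((Li_isBigO m).comp_tendsto (arg0_tendsto hx θ)).trans ?_
  refine IsBigO.of_bound 1 (Eventually.of_forall fun t => ?_)
  simp [norm_arg0]

lemma G_tendsto (m : ℕ) {x : ℂ} (hx : 0 < x.re) (θ : ℝ) :
    Tendsto (fun t => Li (m+1) (arg0 x θ t)) atTop (𝓝 0) :=
  ((Li_isBigO m).comp_tendsto (arg0_tendsto hx θ)).trans_tendsto (arg0_tendsto hx θ)

lemma G_deriv (m : ℕ) {x : ℂ} (hx : 0 < x.re) (θ : ℝ) {t : ℝ} (ht : 0 < t) :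
    HasDerivAt (fun t => Li (m+2) (arg0 x θ t)) (-x * Li (m+1) (arg0 x θ t)) t := by
  have h := (Li_hasDerivAt m (arg0_lt hx θ ht)).comp t (arg0_hasDerivAt x θ t)
  convert! h using 1
  rw [← mul_deriv_Li m (arg0_lt hx θ ht)]; ring

lemma V_deriv (θ : ℝ) {t : ℝ} (ht : 0 < t) :
    HasDerivAt (fun t => Li 1 (arg0 1 θ t)) (1 - 1 / (1 - arg0 1 θ t)) t := by
  have hl := arg0_lt (x := 1) (by simp) θ ht
  have h := (Li_one_hasDerivAt hl).comp t (arg0_hasDerivAt 1 θ t)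
  convert! h using 1
  have : 1 - arg0 1 θ t ≠ 0 := by
    intro h0
    rw [← sub_eq_zero.1 h0] at hl
    simp at hl
  field_simp
  ring

lemma integrable_mul (m : ℕ) {x : ℂ} (hx : 0 < x.re) {θ : ℝ} (h : ∀ n : ℤ, θ ≠ n)
    {f : ℝ → ℂ} {c : ℂ} (hf : ContinuousOn f (Ici 0)) (hc : Tendsto f atTop (𝓝 c)) :
    IntegrableOn (fun t => Li (m+1) (arg0 x θ t) * f t) (Ioi 0) := by
  have hcont := (G_cont m hx h).mul hf
  have hO := (G_bigO m hx θ).mul (hc.isBigO_one ℝ)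
  simp only [mul_one] at hO
  have hi := integrable_of_isBigO_exp_neg hx hcont.norm hO.norm_left
  refine (integrable_norm_iff ?_).1 hi
  exact (hcont.mono Ioi_subset_Ici_self).aestronglyMeasurable measurableSet_Ioi

/-- For `k ≥ 3`, `F_k(x,α,β) := -x ∫₀^∞ Li_{k-2}(e^{-xt} e^{2πiα}) Li₁(e^{-t} e^{2πiβ}) dt`
equals `Log(1-e^{2πiβ}) Li_{k-1}(e^{2πiα}) + 𝓕_k(x;α,β) - (1/x) Li_k(e^{2πiα})`. -/
theorem Fk_eq_HHZN (k : ℕ) (hk : 3 ≤ k) (α β : ℝ)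
    (hα : ∀ n : ℤ, α ≠ n) (hβ : ∀ n : ℤ, β ≠ n) (x : ℂ) (hx : 0 < x.re) :
    -x * ∫ t in Set.Ioi (0:ℝ),
        Li (k - 2) (Complex.exp (-x * t) * e2pi α) * Li 1 (Complex.exp (-(t : ℂ)) * e2pi β)
      = Complex.log (1 - e2pi β) * Li (k - 1) (e2pi α) + HHZN k x α β -
          x⁻¹ * Li k (e2pi α) := by
  obtain ⟨m, rfl⟩ : ∃ m, k = m + 3 := ⟨k - 3, by omega⟩
  have h1 : (0:ℝ) < (1:ℂ).re := by simp
  have hx0 : x ≠ 0 := by rintro rfl; simp at hx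
  have hI1 := integrable_mul m hx hα (G_cont 0 h1 hβ) (G_tendsto 0 h1 β)
  have hI2 := integrable_mul (m+1) hx hα (f := fun t => (1 - arg0 1 β t)⁻¹) (c := (1 - 0)⁻¹)
    (ContinuousOn.inv₀ (continuousOn_const.sub (arg0_continuous 1 β).continuousOn)
      (fun t ht h0 => (arg0_mem h1 hβ ht).2 (sub_eq_zero.1 h0).symm))
    (((arg0_tendsto h1 β).const_sub 1).inv₀ (by simp))
  have hd : ∀ t ∈ Ioi (0:ℝ), HasDerivAt
      (fun t => Li (m+2) (arg0 x α t) * Li 1 (arg0 1 β t) + x⁻¹ * Li (m+3) (arg0 x α t))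
      (-x * (Li (m+1) (arg0 x α t) * Li 1 (arg0 1 β t))
        - Li (m+2) (arg0 x α t) * (1 - arg0 1 β t)⁻¹) t := by
    intro t ht
    convert! ((G_deriv m hx α ht).mul (V_deriv β ht)).add
      ((G_deriv (m+1) hx α ht).const_mul x⁻¹) using 1
    field_simp
    ring
  have hc : ContinuousOn
      (fun t => Li (m+2) (arg0 x α t) * Li 1 (arg0 1 β t) + x⁻¹ * Li (m+3) (arg0 x α t))
      (Ici 0) :=
    ((G_cont (m+1) hx hα).mul (G_cont 0 h1 hβ)).add
      (continuousOn_const.mul (G_cont (m+2) hx hα))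
  have ht : Tendsto
      (fun t => Li (m+2) (arg0 x α t) * Li 1 (arg0 1 β t) + x⁻¹ * Li (m+3) (arg0 x α t))
      atTop (𝓝 0) := by
    simpa using ((G_tendsto (m+1) hx α).mul (G_tendsto 0 h1 β)).add
      ((G_tendsto (m+2) hx α).const_mul x⁻¹)
  have key := integral_Ioi_of_hasDerivAt_of_tendsto (hc 0 self_mem_Ici) hd
    ((hI1.const_mul (-x)).sub hI2) ht
  rw [integral_sub (hI1.const_mul (-x)) hI2, integral_const_mul] at key
  have e0 : ∀ y θ, arg0 y θ 0 = e2pi θ := fun y θ => by simp [arg0]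
  simp only [e0] at key
  have e1 : ∀ t : ℝ, Complex.exp (-(t:ℂ)) * e2pi β = arg0 1 β t := fun t => by simp [arg0]
  have e2 : ∀ t : ℝ, Complex.exp (-x * t) * e2pi α = arg0 x α t := fun t => rfl
  have e3 : Li 1 (e2pi β) = -Complex.log (1 - e2pi β) := rfl
  simp only [HHZN, e1, e2, div_eq_mul_inv, show m + 3 - 2 = m + 1 by omega,
    show m + 3 - 1 = m + 2 by omega]
  rw [e3] at key
  linear_combination key

end
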